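/- For every f in the Connes–Kreimer Hopf algebra H with antipode S, the rooted tree map of S(f) equals the τ-conjugate of the rooted tree map of f: (S(f))~ = τ ∘ f̃ ∘ τ as linear endomorphisms of A_r. -/

import Mathlib

open FreeAlgebra

/-- Alphabet of `A_1 = ℚ⟨x,y⟩`. -/
inductive LetA : Type | x : LetA | y : LetA

/-- Alphabet of `A_r = ℚ⟨x, y_s : s ∈ μ_r⟩`; the group `G` plays the role of `μ_r`. -/
inductive LetR (G : Type) : Type | x : LetR G | y : G → LetR G

/-- `A_1 = ℚ⟨x, y⟩`. -/
abbrev A1 : Type := FreeAlgebra ℚ LetA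

/-- `A_r = ℚ⟨x, y_s : s ∈ μ_r⟩`. -/
abbrev Ar (G : Type) : Type := FreeAlgebra ℚ (LetR G)

noncomputable def X1 : A1 := ι ℚ LetA.x
noncomputable def Y1 : A1 := ι ℚ LetA.y

variable {G : Type} [CommGroup G]

noncomputable def Xr : Ar G := ι ℚ LetR.x
noncomputable def Yr (s : G) : Ar G := ι ℚ (LetR.y s)

/-- `z = x + y_1`. -/
noncomputable def zet : Ar G := Xr + Yr 1

open scoped Classical in
/-- `z_s^δ = x + δ(s) y_s` with `δ(1) = 0`, `δ(s) = 1` otherwise. -/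
noncomputable def zdel (s : G) : Ar G := if s = 1 then Xr else Xr + Yr s

/-- The involutive automorphism `φ` of `A_r`: `φ(x) = z`, `φ(y_s) = z_s^δ - z`. -/
noncomputable def phi : Ar G →ₐ[ℚ] Ar G :=
  lift ℚ (fun l => match l with
    | LetR.x => zet
    | LetR.y s => zdel s - zet)

/-- The natural embedding `A_1 → A_r`, `x ↦ x`, `y ↦ y_1`. -/
noncomputable def jm : A1 →ₐ[ℚ] Ar G :=
  lift ℚ (fun l => match l with
    | LetA.x => Xr
    | LetA.y => Yr 1)

open scoped Classical in
/-- The anti-automorphism `τ` of `A_r`: `τ(x) = y_1`, `τ(y_1) = x`, `τ(y_s) = -y_s` (`s ≠ 1`). -/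
noncomputable def tauR : Ar G →ₗ[ℚ] Ar G :=
  (MulOpposite.opLinearEquiv ℚ).symm.toLinearMap ∘ₗ
    (lift ℚ (fun l => match l with
      | LetR.x => MulOpposite.op (Yr 1)
      | LetR.y s => MulOpposite.op (if s = 1 then Xr else -(Yr s)) ) :
        Ar G →ₐ[ℚ] (Ar G)ᵐᵒᵖ).toLinearMap

/-- The anti-automorphism `τ` of `A_1`: `τ(x) = y`, `τ(y) = x`. -/
noncomputable def tau1 : A1 →ₗ[ℚ] A1 :=
  (MulOpposite.opLinearEquiv ℚ).symm.toLinearMap ∘ₗ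
    (lift ℚ (fun l => match l with
      | LetA.x => MulOpposite.op Y1
      | LetA.y => MulOpposite.op X1) : A1 →ₐ[ℚ] A1ᵐᵒᵖ).toLinearMap

/-- `wordP [(a₁,s₁),...,(a_l,s_l)] = x^{a₁} y_{s₁} ⋯ x^{a_l} y_{s_l}`,
i.e. the word `z_{a₁+1, s₁} ⋯ z_{a_l+1, s_l}`. -/
noncomputable def wordP (L : List (ℕ × G)) : Ar G :=
  (L.map (fun p => Xr ^ p.1 * Yr p.2)).prod

/-- Cumulative-product reindexing of subscripts: this realizes the composition `I ∘ M_s`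
on subscript lists, sending `(s₁, s₂, …, s_l)` to `(s s₁, s s₁ s₂, …, s s₁ ⋯ s_l)`. -/
def cumul : G → List (ℕ × G) → List (ℕ × G)
  | _, [] => []
  | g, p :: L => (p.1, g * p.2) :: cumul (g * p.2) L

/-- All the data entering the definition of the diamond products `⋄_s`:
the harmonic product `*`, the maps `ψ_s = φ ∘ I ∘ M_s`, and the family of
`ℚ`-bilinear diamond products `D s : A_1 × A_r → A_r` (together with the
corestriction `D1` of `⋄_1` to `A_1 × A_1 → A_1`), each characterized by its
defining recursive rules. -/
structure DiamondSetup (G : Type) [CommGroup G] where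
  /-- the harmonic product -/
  hst : Ar G →ₗ[ℚ] Ar G →ₗ[ℚ] Ar G
  one_hst : ∀ w, hst 1 w = w
  hst_one : ∀ v, hst v 1 = v
  hst_xr : ∀ v w, hst (v * Xr) w = hst v w * Xr
  hst_xl : ∀ v w, hst v (w * Xr) = hst v w * Xr
  hst_yy : ∀ (v w : Ar G) (s t : G), hst (v * Yr s) (w * Yr t) =
      hst v (w * Yr t) * Yr s + hst (v * Yr s) w * Yr t + hst v w * (Xr * Yr (s * t))
  /-- the linear automorphisms `ψ_s = φ ∘ I ∘ M_s` -/
  psi : G → (Ar G ≃ₗ[ℚ] Ar G)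
  psi_spec : ∀ (s : G) (L : List (ℕ × G)) (a : ℕ),
      psi s (wordP L * Xr ^ a) = phi (wordP (cumul s L) * Xr ^ a)
  /-- the diamond products `⋄_s : A_1 × A_r → A_r` -/
  D : G → A1 →ₗ[ℚ] Ar G →ₗ[ℚ] Ar G
  one_D : ∀ (s : G) (w : Ar G), D s 1 w = w
  D_one : ∀ (s : G) (v : A1), D s v 1 = psi s (phi (jm v))
  Dxx : ∀ (s : G) (v : A1) (w : Ar G), D s (v * X1) (w * Xr) =
      D s v (w * Xr) * Xr - D s (v * Y1) w * Xr
  Dyx : ∀ (s : G) (v : A1) (w : Ar G), D s (v * Y1) (w * Xr) =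
      D s v (w * Xr) * Yr 1 + D s (v * Y1) w * Xr
  Dxy : ∀ (s : G) (v : A1) (w : Ar G), D s (v * X1) (w * Yr 1) =
      D s v (w * Yr 1) * Xr + D s (v * X1) w * Yr 1
  Dyy : ∀ (s : G) (v : A1) (w : Ar G), D s (v * Y1) (w * Yr 1) =
      D s v (w * Yr 1) * Yr 1 - D s (v * X1) w * Yr 1
  Dxyt : ∀ (s t : G), t ≠ 1 → ∀ (v : A1) (w : Ar G), D s (v * X1) (w * Yr t) =
      D s v (w * Yr t) * Xr + D s v (w * (Xr + Yr t)) * Yr t - D s (v * Y1) w * Yr t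
  Dyyt : ∀ (s t : G), t ≠ 1 → ∀ (v : A1) (w : Ar G), D s (v * Y1) (w * Yr t) =
      D s v (w * Yr t) * Yr 1 - D s v (w * (Xr + Yr t)) * Yr t + D s (v * Y1) w * Yr t
  /-- `⋄_1` as a product `A_1 × A_1 → A_1` -/
  D1 : A1 →ₗ[ℚ] A1 →ₗ[ℚ] A1
  D1_spec : ∀ u v : A1, jm (D1 u v) = D 1 u (jm v)

open TensorProduct in
/-- Evaluation of a family of endomorphisms at a fixed element, as a linear map. -/
noncomputable def evalT {G : Type} [CommGroup G] {H : Type} [CommRing H] [HopfAlgebra ℚ H]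
    (T : H →ₐ[ℚ] Module.End ℚ (Ar G)) (w : Ar G) : H →ₗ[ℚ] Ar G :=
  (LinearMap.applyₗ w).comp T.toLinearMap

open TensorProduct in
/-- The linear map `H ⊗ H → A_r` induced by the bilinear map `(a, b) ↦ (T a)(w) ⋅ (T b)(v)`. -/
noncomputable def Tpair {G : Type} [CommGroup G] {H : Type} [CommRing H] [HopfAlgebra ℚ H]
    (T : H →ₐ[ℚ] Module.End ℚ (Ar G)) (w v : Ar G) : H ⊗[ℚ] H →ₗ[ℚ] Ar G :=
  TensorProduct.lift (((LinearMap.mul ℚ (Ar G)).compl₂ (evalT T v)).comp (evalT T w))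

open TensorProduct in
/-- The Connes–Kreimer Hopf algebra of rooted forests `H` together with the grafting
operator `B_+`, the rooted tree maps `f ↦ f̃`, and the polynomials `F_f`, `G_f ∈ A_1`,
each characterized by its defining properties. -/
structure CKSetup (G : Type) [CommGroup G] (H : Type) [CommRing H] [HopfAlgebra ℚ H] where
  /-- the diamond/harmonic data on `A_1`, `A_r` -/
  ds : DiamondSetup G
  /-- the grafting operator `B_+` -/
  Bp : H →ₗ[ℚ] H
  /-- the Hochschild 1-cocycle property `Δ(B_+(f)) = B_+(f) ⊗ 𝟙 + (id ⊗ B_+)(Δ f)` -/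
  Bp_cocycle : ∀ f : H, Coalgebra.comul (R := ℚ) (Bp f) =
      (Bp f) ⊗ₜ[ℚ] (1 : H) + (TensorProduct.map LinearMap.id Bp) (Coalgebra.comul (R := ℚ) f)
  /-- `H` is generated by rooted forests: it is the smallest subspace containing `1` and
  closed under multiplication and `B_+`. -/
  hgen : ∀ P : Submodule ℚ H, (1 : H) ∈ P → (∀ a b : H, a ∈ P → b ∈ P → a * b ∈ P) →
      (∀ a ∈ P, Bp a ∈ P) → ∀ h : H, h ∈ P
  /-- the rooted tree maps `f ↦ f̃`, an algebra homomorphism `H → End(A_r)` -/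
  T : H →ₐ[ℚ] Module.End ℚ (Ar G)
  /-- rule (I): `•̃(z_s^δ) = z_s^δ (z - z_s^δ)` -/
  T_dot_zdel : ∀ s : G, T (Bp 1) (zdel s) = zdel s * (zet - zdel s)
  /-- rule (I): `•̃(z) = 0` -/
  T_dot_z : T (Bp 1) (zet : Ar G) = 0
  /-- rule (II): `B_+(f)~(z_s^δ) = R_{z-z_s^δ} R_{2z-z_s^δ} R_{z-z_s^δ}^{-1} f̃(z_s^δ)` -/
  T_graft : ∀ f : H, Coalgebra.counit (R := ℚ) f = 0 → ∀ (s : G) (u : Ar G),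
      T f (zdel s) = u * (zet - zdel s) →
      T (Bp f) (zdel s) = u * ((2 : ℚ) • zet - zdel s) * (zet - zdel s)
  /-- `f̃(z_s^δ)` always ends with `z - z_s^δ` (so that rule (II) makes sense) -/
  T_ends : ∀ f : H, Coalgebra.counit (R := ℚ) f = 0 → ∀ s : G, ∃ u : Ar G,
      T f (zdel s) = u * (zet - zdel s)
  /-- rule (II): `B_+(f)~(z) = 0` -/
  T_graft_z : ∀ f : H, T (Bp f) (zet : Ar G) = 0
  /-- rule (IV): `f̃(wv) = M(Δ(f)~(w ⊗ v))` for `v ∈ {z, z_s^δ}` -/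
  T_coprod : ∀ (f : H) (w v : Ar G), (v = zet ∨ ∃ s : G, v = zdel s) →
      T f (w * v) = Tpair T w v (Coalgebra.comul (R := ℚ) f)
  /-- the polynomials `F_f ∈ A_1` -/
  F : H →ₗ[ℚ] A1
  F_one : F 1 = 1
  F_dot : F (Bp 1) = Y1
  F_ends : ∀ f : H, Coalgebra.counit (R := ℚ) f = 0 → ∃ u : A1, F f = u * Y1
  /-- `F_{B_+(f)} = R_y R_{x+2y} R_y^{-1}(F_f)` for `f ≠ 𝟙` -/
  F_graft : ∀ f : H, Coalgebra.counit (R := ℚ) f = 0 → ∀ u : A1, F f = u * Y1 →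
      F (Bp f) = u * (X1 + (2 : ℚ) • Y1) * Y1
  /-- `F_{gh} = F_g ⋄_1 F_h` -/
  F_mul : ∀ g h : H, F (g * h) = ds.D1 (F g) (F h)
  /-- the polynomials `G_f ∈ A_1` -/
  Gm : H →ₗ[ℚ] A1
  Gm_one : Gm 1 = 1
  Gm_dot : Gm (Bp 1) = -Y1
  /-- `G_{B_+(f)} = L_{2x+y}(G_f)` for `f ≠ 𝟙` -/
  Gm_graft : ∀ f : H, Coalgebra.counit (R := ℚ) f = 0 →
      Gm (Bp f) = ((2 : ℚ) • X1 + Y1) * Gm f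
  /-- `G_{gh} = G_g ⋄_1 G_h` -/
  Gm_mul : ∀ g h : H, Gm (g * h) = ds.D1 (Gm g) (Gm h)


namespace RTM
open Coalgebra HopfAlgebra WithConv TensorProduct

variable {H : Type} [CommRing H] [HopfAlgebra ℚ H]

section conv
variable {B : Type} [Ring B] [Algebra ℚ B]

/-- constant maps in the convolution algebra -/
noncomputable def kk (H : Type) [CommRing H] [HopfAlgebra ℚ H] (b : B) : WithConv (H →ₗ[ℚ] B) :=
  toConv ((counit (R := ℚ) (A := H)).smulRight b)

@[simp] lemma kk_apply (b : B) (f : H) : kk H b f = counit (R := ℚ) f • b := rfl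

lemma kk_mul (b : B) (L : WithConv (H →ₗ[ℚ] B)) (f : H) : (kk H b * L) f = b * L f := by
  rw [(ℛ ℚ f).convMul_apply]
  conv_rhs => rw [← sum_counit_smul (ℛ ℚ f)]
  simp only [kk_apply, map_sum, map_smul, Finset.mul_sum, smul_mul_assoc, mul_smul_comm]

lemma sum_smul_counit (f : H) :
    ∑ i ∈ (ℛ ℚ f).index, counit (R := ℚ) ((ℛ ℚ f).right i) • (ℛ ℚ f).left i = f := by
  have := congrArg (TensorProduct.lift (LinearMap.lsmul ℚ H).flip) (sum_tmul_counit_eq (R := ℚ) (ℛ ℚ f))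
  simpa only [map_sum, TensorProduct.lift.tmul, LinearMap.flip_apply, LinearMap.lsmul_apply, one_smul]
    using this

lemma mul_kk (b : B) (L : WithConv (H →ₗ[ℚ] B)) (f : H) : (L * kk H b) f = L f * b := by
  rw [(ℛ ℚ f).convMul_apply]
  conv_rhs => rw [← sum_smul_counit f]
  simp only [kk_apply, map_sum, map_smul, Finset.sum_mul, smul_mul_assoc, mul_smul_comm]

end conv

section deg

/-- homogenisation -/
noncomputable def hmg : Ar G →ₐ[ℚ] Polynomial (Ar G) :=
  lift ℚ (fun l => Polynomial.C (ι ℚ l) * Polynomial.X)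

lemma eval_hmg (a : Ar G) : (hmg a).eval 1 = a := by
  induction a using FreeAlgebra.induction with
  | grade0 r =>
    rw [AlgHom.commutes, Polynomial.algebraMap_apply, Polynomial.eval_C]
  | grade1 l =>
    rw [hmg, FreeAlgebra.lift_ι_apply, Polynomial.eval_mul_X, Polynomial.eval_C, mul_one]
  | mul a b ha hb =>
    rw [map_mul, Polynomial.eval, Polynomial.eval₂_mul_noncomm, ← Polynomial.eval, ← Polynomial.eval,
      ha, hb]
    intro k
    exact Commute.one_right _
  | add a b ha hb => simp [ha, hb]

lemma hmg_zdel (s : G) : hmg (zdel s) = Polynomial.C (zdel s) * Polynomial.X := by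
  unfold zdel; split <;> simp [Xr, Yr, hmg, add_mul]

lemma deg_zero (s : G) (c d : H → Ar G)
    (h : ∀ f, d f = zdel s * ∑ i ∈ (ℛ ℚ f).index, c ((ℛ ℚ f).right i) * d ((ℛ ℚ f).left i)) :
    ∀ f, d f = 0 := by
  have key : ∀ n f, (hmg (d f)).coeff n = 0 := by
    intro n
    induction n using Nat.strong_induction_on with
    | _ n ih =>
      intro f
      rw [h f, map_mul, hmg_zdel, mul_assoc, Polynomial.coeff_C_mul]
      cases n with
      | zero => simp
      | succ n =>
        rw [Polynomial.coeff_X_mul, map_sum, Polynomial.finsetSum_coeff, Finset.sum_eq_zero, mul_zero]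
        intro i _
        rw [map_mul, Polynomial.coeff_mul]
        apply Finset.sum_eq_zero
        intro p hp
        rw [ih p.2 (by have := Finset.HasAntidiagonal.mem_antidiagonal.1 hp; omega), mul_zero]
  intro f
  rw [← eval_hmg (d f), show hmg (d f) = 0 from Polynomial.ext (fun n => by rw [key]; simp)]
  simp

end deg

section tau

@[simp] lemma tau_mul (a b : Ar G) : tauR (a * b) = tauR b * tauR a := by simp [tauR]
@[simp] lemma tau_one : tauR (1 : Ar G) = 1 := by simp [tauR]
lemma tau_X : tauR (Xr : Ar G) = Yr 1 := by simp [tauR, Xr]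
lemma tau_Y1 : tauR (Yr 1 : Ar G) = Xr := by simp [tauR, Yr]
lemma tau_Y (s : G) (hs : s ≠ 1) : tauR (Yr s : Ar G) = - Yr s := by
  classical
  have : (FreeAlgebra.lift ℚ (fun l : LetR G => match l with
      | LetR.x => MulOpposite.op (Yr 1)
      | LetR.y s => MulOpposite.op (if s = 1 then Xr else -(Yr s)) ) :
        Ar G →ₐ[ℚ] (Ar G)ᵐᵒᵖ) (Yr s) = MulOpposite.op (-(Yr s)) := by
    have := FreeAlgebra.lift_ι_apply (R := ℚ) (fun l : LetR G => match l with
      | LetR.x => MulOpposite.op (Yr 1 : Ar G)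
      | LetR.y s => MulOpposite.op (if s = 1 then Xr else -(Yr s))) (LetR.y s)
    simp only [hs, if_false] at this
    exact this
  exact congrArg MulOpposite.unop this
@[simp] lemma tau_z : tauR (zet : Ar G) = zet := by simp [zet, tau_X, tau_Y1, add_comm]
@[simp] lemma tau_zdel (s : G) : tauR (zdel s) = zet - zdel s := by
  unfold zdel; split
  · simp [tau_X, zet]
  · simp only [map_add, tau_X, tau_Y s ‹_›, zet]; abel

/-- induction principle -/
lemma gen_induction (p : Ar G → Prop) (h1 : p 1) (hadd : ∀ a b, p a → p b → p (a + b))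
    (hsmul : ∀ (r : ℚ) a, p a → p (r • a))
    (hz : ∀ b, p b → p (zet * b)) (hv : ∀ s b, p b → p (zdel s * b)) : ∀ a, p a := by
  have hg : ∀ (l : LetR G) b, p b → p (ι ℚ l * b) := by
    have hX : ∀ b, p b → p (Xr * b) := fun b hb => by simpa [zdel] using hv 1 b hb
    intro l b hb
    cases l with
    | x => exact hX b hb
    | y s =>
      by_cases hs : s = 1
      · subst hs
        have : ι ℚ (LetR.y 1) * b = zet * b + (-1 : ℚ) • (Xr * b) := by
          simp [zet, Yr, add_mul]
        rw [this]; exact hadd _ _ (hz b hb) (hsmul _ _ (hX b hb))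
      · have : ι ℚ (LetR.y s) * b = zdel s * b + (-1 : ℚ) • (Xr * b) := by
          simp [zdel, hs, Yr, add_mul]
        rw [this]; exact hadd _ _ (hv s b hb) (hsmul _ _ (hX b hb))
  have hm : ∀ a b, p b → p (a * b) := by
    intro a
    induction a using FreeAlgebra.induction with
    | grade0 r => intro b hb; rw [← Algebra.smul_def]; exact hsmul r b hb
    | grade1 l => exact hg l
    | mul a b ha hb => intro c hc; rw [mul_assoc]; exact ha _ (hb _ hc)
    | add a b ha hb => intro c hc; rw [add_mul]; exact hadd _ _ (ha c hc) (hb c hc)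
  intro a
  simpa using hm a 1 h1

/-- evaluation to commutative polynomials to separate generators -/
lemma tau_tau (a : Ar G) : tauR (tauR a) = a := by
  refine gen_induction (fun a => tauR (tauR a) = a) (by simp) ?_ ?_ ?_ ?_ a
  · intro a b ha hb; simp [ha, hb]
  · intro r a ha; simp [ha]
  · intro b hb; simp [hb]
  · intro s b hb; simp [hb]

lemma zdel_ne (s : G) : (zdel s : Ar G) ≠ 0 := by
  intro h
  have := congrArg (lift ℚ (fun l : LetR G => match l with
    | LetR.x => (1 : ℚ)
    | LetR.y _ => 0)) h
  unfold zdel at this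
  split at this <;> simp [Xr, Yr] at this

lemma sub_ne (s : G) : (zet - zdel s : Ar G) ≠ 0 := by
  rw [← tau_zdel]; intro h
  apply zdel_ne s
  rw [← tau_tau (zdel s), h, map_zero]

lemma zet_ne : (zet : Ar G) ≠ 0 := by
  intro h
  have := congrArg (lift ℚ (fun l : LetR G => match l with
    | LetR.x => (1 : ℚ)
    | LetR.y _ => 0)) h
  simp [zet, Xr, Yr] at this

end tau

section main
variable (C : CKSetup G H)

/-- `a ↦ (f ↦ f̃(a))` -/
noncomputable def rho (a : Ar G) : WithConv (H →ₗ[ℚ] Ar G) := toConv (evalT C.T a)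

@[simp] lemma rho_apply (a : Ar G) (f : H) : rho C a f = C.T f a := rfl

lemma conv_ext {B : Type} [Ring B] [Algebra ℚ B] {L M : WithConv (H →ₗ[ℚ] B)}
    (h : ∀ f, L f = M f) : L = M := by
  apply WithConv.ext; apply LinearMap.ext; exact h

lemma counit_Bp (f : H) : counit (R := ℚ) (C.Bp f) = 0 := by
  have h := congrArg (TensorProduct.map (counit (R := ℚ) (A := H)) (counit (R := ℚ) (A := H)))
    (C.Bp_cocycle f)
  have h2 := congrArg (TensorProduct.lid ℚ ℚ) h
  have e1 : ∀ x : H, TensorProduct.map (counit (R := ℚ) (A := H)) (counit (R := ℚ) (A := H))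
      (comul x) = 1 ⊗ₜ counit (R := ℚ) x := by
    intro x
    have := congrArg (LinearMap.lTensor ℚ (counit (R := ℚ) (A := H)))
      (rTensor_counit_comul (R := ℚ) x)
    rwa [← LinearMap.comp_apply, LinearMap.lTensor_comp_rTensor, LinearMap.lTensor_tmul] at this
  have e2 : TensorProduct.map (counit (R := ℚ) (A := H)) (counit (R := ℚ) (A := H))
      (TensorProduct.map LinearMap.id C.Bp (comul f)) = 1 ⊗ₜ counit (R := ℚ) (C.Bp f) := by
    have := congrArg (LinearMap.lTensor ℚ (counit (R := ℚ) (A := H) ∘ₗ C.Bp))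
      (rTensor_counit_comul (R := ℚ) f)
    rw [← LinearMap.comp_apply, LinearMap.lTensor_comp_rTensor, LinearMap.lTensor_tmul] at this
    rw [← LinearMap.comp_apply, ← TensorProduct.map_comp]
    exact this
  rw [map_add, e1, e2] at h2
  simpa using h2

lemma conv_Bp {B : Type} [Ring B] [Algebra ℚ B] (L M : WithConv (H →ₗ[ℚ] B)) (f : H) :
    (L * M) (C.Bp f) = L (C.Bp f) * M 1 + (L * toConv (M.ofConv ∘ₗ C.Bp)) f := by
  rw [LinearMap.convMul_apply, C.Bp_cocycle, map_add, map_add, TensorProduct.map_tmul,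
    LinearMap.mul'_apply, LinearMap.convMul_apply]
  congr 2
  rw [← LinearMap.comp_apply, ← TensorProduct.map_comp]
  rfl

lemma T_z (f : H) : C.T f (zet : Ar G) = counit (R := ℚ) f • zet := by
  have h := C.hgen (LinearMap.ker (evalT C.T zet - (counit (R := ℚ) (A := H)).smulRight zet))
    (by simp [evalT]) ?_ ?_ f
  · simpa [evalT, sub_eq_zero] using h
  · intro a b ha hb
    simp only [evalT, LinearMap.mem_ker, LinearMap.sub_apply, LinearMap.comp_apply,
      LinearMap.smulRight_apply, sub_eq_zero, AlgHom.toLinearMap_apply, LinearMap.applyₗ_apply_apply] at *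
    rw [map_mul, Module.End.mul_apply, hb, map_smul, ha, Bialgebra.counit_mul, mul_comm, mul_smul]
  · intro a _
    simp [evalT, C.T_graft_z, counit_Bp]

lemma rho_z : rho C zet = kk H zet := conv_ext fun f => by simp [T_z]

lemma rho_gen (w v : Ar G) (hv : v = zet ∨ ∃ s : G, v = zdel s) :
    rho C (w * v) = rho C w * rho C v := by
  apply conv_ext; intro f
  rw [(ℛ ℚ f).convMul_apply, rho_apply, C.T_coprod f w v hv, ← (ℛ ℚ f).eq]
  simp [Tpair, evalT]

lemma rho_one : rho C 1 = 1 := by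
  apply conv_ext; intro f
  have h := congrArg (fun L => L f) (rho_gen C 1 zet (Or.inl rfl))
  simp only [one_mul] at h
  rw [rho_z, mul_kk, kk_apply, rho_apply] at h
  rw [rho_apply, LinearMap.convOne_apply]
  apply mul_right_cancel₀ zet_ne
  rw [← h, Algebra.smul_def]

lemma rho_add (a b : Ar G) : rho C (a + b) = rho C a + rho C b := conv_ext fun f => by
  change C.T f (a + b) = C.T f a + C.T f b
  simp
lemma rho_sub (a b : Ar G) : rho C (a - b) = rho C a - rho C b := conv_ext fun f => by
  change C.T f (a - b) = C.T f a - C.T f b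
  simp
lemma rho_smul (r : ℚ) (a : Ar G) : rho C (r • a) = r • rho C a := conv_ext fun f => by
  change C.T f (r • a) = r • C.T f a
  simp

lemma rho_mul (a b : Ar G) : rho C (a * b) = rho C a * rho C b := by
  have hX : ∀ a, rho C (a * Xr) = rho C a * rho C Xr := fun a =>
    rho_gen C a Xr (Or.inr ⟨1, by simp [zdel]⟩)
  induction b using FreeAlgebra.induction generalizing a with
  | grade0 r =>
    rw [Algebra.algebraMap_eq_smul_one, mul_smul_comm, mul_one, rho_smul, rho_smul, rho_one,
      mul_smul_comm, mul_one]
  | grade1 l =>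
    cases l with
    | x => exact hX a
    | y s =>
      by_cases hs : s = 1
      · subst hs
        have : ι ℚ (LetR.y 1) = (zet : Ar G) - Xr := by simp [zet, Yr]
        rw [this, mul_sub, rho_sub, rho_sub, mul_sub, hX, rho_gen C a zet (Or.inl rfl)]
      · have : ι ℚ (LetR.y s) = (zdel s : Ar G) - Xr := by simp [zdel, Yr, hs]
        rw [this, mul_sub, rho_sub, rho_sub, mul_sub, hX, rho_gen C a (zdel s) (Or.inr ⟨s, rfl⟩)]
  | mul b c hb hc => rw [← mul_assoc, hc, hb, hc, mul_assoc]
  | add b c hb hc => rw [mul_add, rho_add, rho_add, hb, hc, mul_add]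

lemma T_mul_z (f : H) (a : Ar G) : C.T f (a * zet) = C.T f a * zet := by
  have h := congrArg (fun L => L f) (rho_mul C a zet)
  simpa [rho_z, mul_kk, -LinearMap.convMul_apply] using h

lemma T_z_mul (f : H) (a : Ar G) : C.T f (zet * a) = zet * C.T f a := by
  have h := congrArg (fun L => L f) (rho_mul C zet a)
  simpa [rho_z, kk_mul, -LinearMap.convMul_apply] using h

/-- the algebra of polynomials in `z` -/
noncomputable def Qz : Subalgebra ℚ (Ar G) := Algebra.adjoin ℚ {zet}

lemma Qz_induction {p : Ar G → Prop} (hz : p zet) (hr : ∀ r : ℚ, p (algebraMap ℚ _ r))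
    (ha : ∀ x y, p x → p y → p (x + y)) (hm : ∀ x y, p x → p y → p (x * y)) :
    ∀ c ∈ (Qz : Subalgebra ℚ (Ar G)), p c := by
  intro c hc
  induction hc using Algebra.adjoin_induction with
  | mem x hx => rw [Set.mem_singleton_iff.1 hx]; exact hz
  | algebraMap r => exact hr r
  | add x y _ _ h1 h2 => exact ha x y h1 h2
  | mul x y _ _ h1 h2 => exact hm x y h1 h2

lemma T_mul_c (c : Ar G) (hc : c ∈ (Qz : Subalgebra ℚ (Ar G))) :
    ∀ (f : H) (a : Ar G), C.T f (a * c) = C.T f a * c := by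
  refine Qz_induction (p := fun c => ∀ (f : H) (a : Ar G), C.T f (a * c) = C.T f a * c)
    (fun f a => T_mul_z C f a) ?_ ?_ ?_ c hc
  · intro r f a; rw [Algebra.algebraMap_eq_smul_one]; simp
  · intro x y hx hy f a; rw [mul_add, map_add, hx, hy, mul_add]
  · intro x y hx hy f a; rw [← mul_assoc, hy, hx, mul_assoc]

lemma T_c_mul (c : Ar G) (hc : c ∈ (Qz : Subalgebra ℚ (Ar G))) :
    ∀ (f : H) (a : Ar G), C.T f (c * a) = c * C.T f a := by
  refine Qz_induction (p := fun c => ∀ (f : H) (a : Ar G), C.T f (c * a) = c * C.T f a)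
    (fun f a => T_z_mul C f a) ?_ ?_ ?_ c hc
  · intro r f a; rw [Algebra.algebraMap_eq_smul_one]; simp
  · intro x y hx hy f a; rw [add_mul, map_add, hx, hy, add_mul]
  · intro x y hx hy f a; rw [mul_assoc, hx, hy, mul_assoc]

lemma tau_c (c : Ar G) (hc : c ∈ (Qz : Subalgebra ℚ (Ar G))) : tauR c = c ∧ Commute c zet := by
  suffices h : tauR c = c ∧ ∀ y, Commute y zet → Commute c y from ⟨h.1, h.2 zet (Commute.refl _)⟩
  refine Qz_induction (p := fun c => tauR c = c ∧ ∀ y, Commute y zet → Commute c y)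
    ⟨tau_z, fun y hy => hy.symm⟩ ?_ ?_ ?_ c hc
  · intro r
    exact ⟨by rw [Algebra.algebraMap_eq_smul_one]; simp, fun y _ => Algebra.commutes r _⟩
  · intro x y hx hy
    exact ⟨by rw [map_add, hx.1, hy.1], fun w hw => (hx.2 w hw).add_left (hy.2 w hw)⟩
  · intro x y hx hy
    refine ⟨?_, fun w hw => (hx.2 w hw).mul_left (hy.2 w hw)⟩
    rw [tau_mul, hx.1, hy.1]
    exact (hx.2 y (hy.2 zet (Commute.refl _))).symm.eq


/-- `f̃` as an element of the convolution algebra -/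
noncomputable def Tc : WithConv (H →ₗ[ℚ] Module.End ℚ (Ar G)) := toConv C.T.toLinearMap
/-- `S(f)~` as an element of the convolution algebra -/
noncomputable def Th : WithConv (H →ₗ[ℚ] Module.End ℚ (Ar G)) :=
  toConv (C.T.toLinearMap ∘ₗ antipode ℚ)

@[simp] lemma Tc_apply (f : H) : Tc C f = C.T f := rfl
@[simp] lemma Th_apply (f : H) : Th C f = C.T (antipode ℚ f) := rfl

lemma mul_kone {B : Type} [Ring B] [Algebra ℚ B] (L : WithConv (H →ₗ[ℚ] B)) : L * kk H (1 : B) = L :=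
  conv_ext fun f => by rw [mul_kk, mul_one]
lemma kone_mul {B : Type} [Ring B] [Algebra ℚ B] (L : WithConv (H →ₗ[ℚ] B)) : kk H (1 : B) * L = L :=
  conv_ext fun f => by rw [kk_mul, one_mul]
lemma kk_sub {B : Type} [Ring B] [Algebra ℚ B] (a b : B) : kk H (a - b) = kk H a - kk H b :=
  conv_ext fun f => by
    change counit (R := ℚ) f • (a - b) = counit (R := ℚ) f • a - counit (R := ℚ) f • b
    rw [smul_sub]

lemma Th_Tc : Th C * Tc C = kk H 1 := by
  have h := LinearMap.algHom_comp_convMul_distrib C.T (toConv (antipode ℚ (A := H)))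
    (toConv LinearMap.id)
  rw [LinearMap.antipode_mul_id] at h
  apply WithConv.ext
  refine Eq.trans h.symm ?_
  ext f : 1
  simp [LinearMap.convOne_def, kk, Algebra.algebraMap_eq_smul_one]

lemma Tc_Th : Tc C * Th C = kk H 1 := by
  have h := LinearMap.algHom_comp_convMul_distrib C.T
    (toConv LinearMap.id) (toConv (antipode ℚ (A := H)))
  rw [LinearMap.id_mul_antipode] at h
  apply WithConv.ext
  refine Eq.trans h.symm ?_
  ext f : 1
  simp [LinearMap.convOne_def, kk, Algebra.algebraMap_eq_smul_one]

/-- left multiplication operators -/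
noncomputable def lW (L : WithConv (H →ₗ[ℚ] Ar G)) : WithConv (H →ₗ[ℚ] Module.End ℚ (Ar G)) :=
  toConv ((Algebra.lmul ℚ (Ar G)).toLinearMap ∘ₗ L.ofConv)

@[simp] lemma lW_apply (L : WithConv (H →ₗ[ℚ] Ar G)) (f : H) (a : Ar G) : lW L f a = L f * a := rfl

lemma lW_mul (L M : WithConv (H →ₗ[ℚ] Ar G)) : lW (L * M) = lW L * lW M := by
  apply WithConv.ext
  exact LinearMap.algHom_comp_convMul_distrib (Algebra.lmul ℚ (Ar G)) L M

lemma lW_add (L M : WithConv (H →ₗ[ℚ] Ar G)) : lW (L + M) = lW L + lW M :=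
  conv_ext fun f => by
    ext a; change (L f + M f) * a = L f * a + M f * a; rw [add_mul]
lemma lW_sub (L M : WithConv (H →ₗ[ℚ] Ar G)) : lW (L - M) = lW L - lW M :=
  conv_ext fun f => by
    ext a; change (L f - M f) * a = L f * a - M f * a; rw [sub_mul]
lemma lW_smul (r : ℚ) (L : WithConv (H →ₗ[ℚ] Ar G)) : lW (r • L) = r • lW L :=
  conv_ext fun f => by
    ext a; change (r • L f) * a = r • (L f * a); rw [smul_mul_assoc]

/-- constant left multiplication -/
noncomputable abbrev kl (H : Type) [CommRing H] [HopfAlgebra ℚ H] (a : Ar G) :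
    WithConv (H →ₗ[ℚ] Module.End ℚ (Ar G)) := kk H (Algebra.lmul ℚ (Ar G) a)

lemma lW_kk (a : Ar G) : lW (kk H a) = kl H a :=
  conv_ext fun f => by
    ext b; change (counit (R := ℚ) f • a) * b = counit (R := ℚ) f • (a * b); rw [smul_mul_assoc]

lemma Tc_kl (a : Ar G) : Tc C * kl H a = lW (rho C a) * Tc C := by
  apply conv_ext; intro f
  rw [mul_kk]
  ext b
  have h := congrArg (fun L => L f) (rho_mul C a b)
  simp only [rho_apply] at h
  change C.T f (a * b) = _
  rw [h, (ℛ ℚ f).convMul_apply, (ℛ ℚ f).convMul_apply]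
  simp

lemma lW_rho (a : Ar G) : lW (rho C a) = Tc C * kl H a * Th C := by
  rw [Tc_kl, mul_assoc, Tc_Th, mul_kone]

lemma Th_lW_rho (a : Ar G) : Th C * lW (rho C a) = kl H a * Th C := by
  rw [lW_rho, ← mul_assoc, ← mul_assoc, Th_Tc, kone_mul]

lemma exists_u (s : G) : ∃ u : WithConv (H →ₗ[ℚ] Ar G),
    rho C (zdel s) = kk H (zdel s) + u * kk H (zet - zdel s) := by
  obtain ⟨g, hg⟩ := LinearMap.exists_leftInverse_of_injective
    (LinearMap.mulRight ℚ (zet - zdel s : Ar G))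
    (LinearMap.ker_eq_bot.2 (mul_left_injective₀ (sub_ne s)))
  refine ⟨toConv (g ∘ₗ (rho C (zdel s) - kk H (zdel s)).ofConv), conv_ext fun f => ?_⟩
  change _ = kk H (zdel s) f + (toConv _ * kk H _ : WithConv (H →ₗ[ℚ] Ar G)) f
  rw [mul_kk]
  change C.T f (zdel s) = counit (R := ℚ) f • zdel s
    + g (C.T f (zdel s) - counit (R := ℚ) f • zdel s) * (zet - zdel s)
  obtain ⟨w, hw⟩ := C.T_ends (f - counit (R := ℚ) f • 1) (by simp) s
  have hw' : C.T f (zdel s) - counit (R := ℚ) f • zdel s = w * (zet - zdel s) := by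
    rw [← hw]; simp
  have := congrArg (fun L => L w) hg
  simp only [LinearMap.comp_apply, LinearMap.mulRight_apply, LinearMap.id_apply] at this
  rw [hw', this, ← hw']; abel


end main

lemma u_spec {C : CKSetup G H} {s : G} {u : WithConv (H →ₗ[ℚ] Ar G)}
    (hu : rho C (zdel s) = kk H (zdel s) + u * kk H (zet - zdel s)) (f : H) : C.T f (zdel s) = counit (R := ℚ) f • zdel s + u f * (zet - zdel s) := by
  have h := congrArg (fun L => L f) hu
  change _ = kk H (zdel s) f + (u * kk H (zet - zdel s) : WithConv (H →ₗ[ℚ] Ar G)) f at h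
  rwa [mul_kk] at h

lemma u_one {C : CKSetup G H} {s : G} {u : WithConv (H →ₗ[ℚ] Ar G)}
    (hu : rho C (zdel s) = kk H (zdel s) + u * kk H (zet - zdel s)) : u 1 = 0 := by
  have h := u_spec hu 1
  simpa [sub_ne s] using h

lemma u_Bp {C : CKSetup G H} {s : G} {u : WithConv (H →ₗ[ℚ] Ar G)}
    (hu : rho C (zdel s) = kk H (zdel s) + u * kk H (zet - zdel s)) (f : H) : u (C.Bp f) = C.T f (zdel s) + u f * zet := by
  apply mul_right_cancel₀ (sub_ne s)
  have h := u_spec hu (C.Bp f)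
  rw [counit_Bp, zero_smul, zero_add] at h
  rw [← h]
  have e : C.T (f - counit (R := ℚ) f • 1) (zdel s) = u f * (zet - zdel s) := by
    have := u_spec hu f
    simp [this]
  have h2 := C.T_graft (f - counit (R := ℚ) f • 1) (by simp) s _ e
  rw [map_sub, map_smul, map_sub, map_smul, LinearMap.sub_apply, LinearMap.smul_apply,
    C.T_dot_zdel, sub_eq_iff_eq_add] at h2
  rw [h2, u_spec hu f]
  have : (2 : ℚ) • (zet : Ar G) = zet + zet := two_smul _ _
  rw [this]
  simp only [add_mul, mul_sub, sub_mul, mul_add, smul_mul_assoc, smul_sub]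
  abel

lemma u_mul {C : CKSetup G H} {s : G} {u : WithConv (H →ₗ[ℚ] Ar G)}
    (hu : rho C (zdel s) = kk H (zdel s) + u * kk H (zet - zdel s)) (h : H) : toConv (u.ofConv ∘ₗ LinearMap.mulRight ℚ h) =
    counit (R := ℚ) h • u + rho C (u h) - rho C (u h) * u := by
  apply conv_ext; intro f
  apply mul_right_cancel₀ (sub_ne s)
  change u (f * h) * _ = (counit (R := ℚ) h • u f + C.T f (u h) - (rho C (u h) * u : WithConv (H →ₗ[ℚ] Ar G)) f) * _
  have h1 := u_spec hu (f * h)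
  rw [← sub_eq_iff_eq_add'] at h1
  rw [← h1, map_mul, Module.End.mul_apply, u_spec hu h, map_add, map_smul]
  have h2 : rho C (u h * (zet - zdel s)) = rho C (u h) * kk H (zet - zdel s)
      - rho C (u h) * u * kk H (zet - zdel s) := by
    rw [rho_mul, rho_sub, rho_z, hu, mul_assoc, ← mul_sub, ← sub_sub, ← kk_sub]
  have h3 := congrArg (fun L => L f) h2
  change C.T f _ = (rho C (u h) * kk H (zet - zdel s) : WithConv (H →ₗ[ℚ] Ar G)) f
    - (rho C (u h) * u * kk H (zet - zdel s) : WithConv (H →ₗ[ℚ] Ar G)) f at h3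
  rw [mul_kk, mul_kk, rho_apply] at h3
  rw [h3, u_spec hu f, Bialgebra.counit_mul]
  simp only [add_mul, sub_mul, smul_add, smul_mul_assoc, smul_smul]
  rw [mul_comm (counit (R := ℚ) h)]
  abel




/-- the operators `W_f = ∑ S(f₁)~ ∘ u_{f₂}` -/
noncomputable abbrev WW (C : CKSetup G H) (L : WithConv (H →ₗ[ℚ] Ar G)) :
    WithConv (H →ₗ[ℚ] Module.End ℚ (Ar G)) := Th C * lW L

lemma WW_apply (C : CKSetup G H) (L : WithConv (H →ₗ[ℚ] Ar G)) (f : H) (a : Ar G) :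
    WW C L f a = ∑ i ∈ (ℛ ℚ f).index,
      C.T (antipode ℚ ((ℛ ℚ f).left i)) (L ((ℛ ℚ f).right i) * a) := by
  unfold WW
  rw [(ℛ ℚ f).convMul_apply]
  simp

lemma WW_mul_c (C : CKSetup G H) (L : WithConv (H →ₗ[ℚ] Ar G)) (c : Ar G)
    (hc : c ∈ (Qz : Subalgebra ℚ (Ar G))) (f : H) (a : Ar G) :
    WW C L f (a * c) = WW C L f a * c := by
  rw [WW_apply, WW_apply, Finset.sum_mul]
  refine Finset.sum_congr rfl fun i _ => ?_
  rw [← mul_assoc, T_mul_c C c hc]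

lemma WW_add (C : CKSetup G H) (L M : WithConv (H →ₗ[ℚ] Ar G)) (f : H) (a : Ar G) :
    WW C (L + M) f a = WW C L f a + WW C M f a := by
  unfold WW; rw [lW_add, mul_add]; rfl
lemma WW_sub (C : CKSetup G H) (L M : WithConv (H →ₗ[ℚ] Ar G)) (f : H) (a : Ar G) :
    WW C (L - M) f a = WW C L f a - WW C M f a := by
  rw [WW_apply, WW_apply, WW_apply, ← Finset.sum_sub_distrib]
  refine Finset.sum_congr rfl fun i _ => ?_
  rw [← map_sub, ← sub_mul]; rfl
lemma WW_smul (C : CKSetup G H) (r : ℚ) (L : WithConv (H →ₗ[ℚ] Ar G)) (f : H) (a : Ar G) :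
    WW C (r • L) f a = r • WW C L f a := by
  unfold WW; rw [lW_smul, mul_smul_comm]; rfl

lemma WW_mul_kk (C : CKSetup G H) (L : WithConv (H →ₗ[ℚ] Ar G)) (b : Ar G) (f : H) (a : Ar G) :
    WW C (L * kk H b) f a = WW C L f (b * a) := by
  unfold WW; rw [lW_mul, lW_kk, ← mul_assoc, mul_kk]; rfl

lemma WW_kk (C : CKSetup G H) (b : Ar G) (f : H) (a : Ar G) :
    WW C (kk H b) f a = C.T (antipode ℚ f) (b * a) := by
  unfold WW; rw [lW_kk, mul_kk]; rfl

lemma WW_rho (C : CKSetup G H) (b : Ar G) (f : H) (a : Ar G) :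
    WW C (rho C b) f a = b * C.T (antipode ℚ f) a := by
  unfold WW; rw [Th_lW_rho, kk_mul]; rfl

lemma WW_rho_mul (C : CKSetup G H) (L : WithConv (H →ₗ[ℚ] Ar G)) (b : Ar G) (f : H) (a : Ar G) :
    WW C (rho C b * L) f a = b * WW C L f a := by
  unfold WW; rw [lW_mul, ← mul_assoc, Th_lW_rho, mul_assoc, kk_mul]; rfl

lemma T_one_eq (C : CKSetup G H) (f : H) : C.T f (1 : Ar G) = counit (R := ℚ) f • 1 := by
  have h := congrArg (fun L => L f) (rho_one C)
  rw [← Algebra.algebraMap_eq_smul_one]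
  simpa using h

lemma That_one (C : CKSetup G H) (f : H) :
    C.T (antipode ℚ f) (1 : Ar G) = counit (R := ℚ) f • 1 := by
  rw [T_one_eq, counit_antipode]

lemma WW_sub_v {C : CKSetup G H} {s : G} {u : WithConv (H →ₗ[ℚ] Ar G)}
    (hu : rho C (zdel s) = kk H (zdel s) + u * kk H (zet - zdel s)) (f : H) :
    WW C u f (zet - zdel s) = counit (R := ℚ) f • zdel s - C.T (antipode ℚ f) (zdel s) := by
  have h : WW C (rho C (zdel s)) f 1 = WW C (kk H (zdel s) + u * kk H (zet - zdel s)) f 1 := by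
    rw [← hu]
  rw [WW_rho, WW_add, WW_kk, WW_mul_kk, That_one, mul_one, mul_one] at h
  rw [eq_sub_iff_add_eq', ← h]; simp

lemma zet_mem : (zet : Ar G) ∈ (Qz : Subalgebra ℚ (Ar G)) :=
  Algebra.subset_adjoin (Set.mem_singleton _)

lemma U_one {C : CKSetup G H} {s : G} {u : WithConv (H →ₗ[ℚ] Ar G)}
    (hu : rho C (zdel s) = kk H (zdel s) + u * kk H (zet - zdel s)) : WW C u 1 1 = 0 := by
  unfold WW
  rw [LinearMap.convMul_apply, Bialgebra.comul_one, Algebra.TensorProduct.one_def,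
    TensorProduct.map_tmul, LinearMap.mul'_apply]
  change C.T (antipode ℚ 1) (u 1 * 1) = 0
  rw [u_one hu]; simp

lemma U_Bp {C : CKSetup G H} {s : G} {u : WithConv (H →ₗ[ℚ] Ar G)}
    (hu : rho C (zdel s) = kk H (zdel s) + u * kk H (zet - zdel s)) (f : H) :
    WW C u (C.Bp f) 1 = counit (R := ℚ) f • zdel s + WW C u f 1 * zet := by
  have h0 : lW u (1 : H) = 0 := by ext a; rw [lW_apply, u_one hu]; simp
  have h1 : toConv ((lW u).ofConv ∘ₗ C.Bp) = lW (rho C (zdel s) + u * kk H zet) := by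
    apply conv_ext; intro g
    ext a
    change u (C.Bp g) * a
      = (C.T g (zdel s) + (u * kk H zet : WithConv (H →ₗ[ℚ] Ar G)) g) * a
    rw [mul_kk, u_Bp hu]
  have h2 : WW C u (C.Bp f) = WW C (rho C (zdel s) + u * kk H zet) f := by
    unfold WW; rw [conv_Bp, h0, mul_zero, zero_add, h1]
  rw [h2, WW_add, WW_rho, WW_mul_kk, That_one, mul_one, mul_smul_comm, mul_one]
  congr 1
  have := WW_mul_c C u zet zet_mem f 1
  rwa [one_mul] at this

lemma U_inner {C : CKSetup G H} {s : G} {u : WithConv (H →ₗ[ℚ] Ar G)}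
    (hu : rho C (zdel s) = kk H (zdel s) + u * kk H (zet - zdel s)) (f h : H) :
    ∑ i ∈ (ℛ ℚ f).index, C.T (antipode ℚ ((ℛ ℚ f).left i)) (u ((ℛ ℚ f).right i * h)) =
      counit (R := ℚ) h • WW C u f 1 + counit (R := ℚ) f • u h - u h * WW C u f 1 := by
  have e := WW_apply C (toConv (u.ofConv ∘ₗ LinearMap.mulRight ℚ h)) f 1
  rw [u_mul hu, WW_sub, WW_add, WW_smul, WW_rho, WW_rho_mul, That_one, mul_smul_comm,
    mul_one, ← u_mul hu] at e
  rw [e]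
  refine Finset.sum_congr rfl fun i _ => ?_
  rw [mul_one]; rfl

lemma U_mul {C : CKSetup G H} {s : G} {u : WithConv (H →ₗ[ℚ] Ar G)}
    (hu : rho C (zdel s) = kk H (zdel s) + u * kk H (zet - zdel s)) (f g : H) :
    WW C u (f * g) 1 = C.T (antipode ℚ g) (WW C u f 1) + counit (R := ℚ) f • WW C u g 1
      - WW C u g (WW C u f 1) := by
  have e1 : WW C u (f * g) 1 = ∑ j ∈ (ℛ ℚ g).index, C.T (antipode ℚ ((ℛ ℚ g).left j))
      (∑ i ∈ (ℛ ℚ f).index, C.T (antipode ℚ ((ℛ ℚ f).left i))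
        (u ((ℛ ℚ f).right i * (ℛ ℚ g).right j))) := by
    unfold WW
    rw [LinearMap.convMul_apply, Bialgebra.comul_mul]
    nth_rw 1 [← (ℛ ℚ f).eq]
    nth_rw 1 [← (ℛ ℚ g).eq]
    rw [Finset.sum_mul_sum, Finset.sum_comm]
    simp only [map_sum, LinearMap.sum_apply, Algebra.TensorProduct.tmul_mul_tmul,
      TensorProduct.map_tmul, LinearMap.mul'_apply]
    refine Finset.sum_congr rfl fun j _ => Finset.sum_congr rfl fun i _ => ?_
    change C.T (antipode ℚ (_ * _)) (u _ * 1) = _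
    rw [mul_one, antipode_mul_antidistrib, map_mul]; rfl
  rw [e1]
  have e2 := WW_apply C (kk H (WW C u f 1) + counit (R := ℚ) f • u - u * kk H (WW C u f 1)) g 1
  rw [WW_sub, WW_add, WW_smul, WW_mul_kk, WW_kk, mul_one] at e2
  rw [e2]
  refine Finset.sum_congr rfl fun j _ => ?_
  rw [U_inner hu, mul_one]
  congr 1
  change _ = counit (R := ℚ) ((ℛ ℚ g).right j) • WW C u f 1 + counit (R := ℚ) f • u _
    - (u * kk H (WW C u f 1) : WithConv (H →ₗ[ℚ] Ar G)) _
  rw [mul_kk]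

lemma U_mem {C : CKSetup G H} {s : G} {u : WithConv (H →ₗ[ℚ] Ar G)}
    (hu : rho C (zdel s) = kk H (zdel s) + u * kk H (zet - zdel s)) (f : H) :
    ∃ c ∈ (Qz : Subalgebra ℚ (Ar G)), WW C u f 1 = zdel s * c := by
  let U : H →ₗ[ℚ] Ar G := (LinearMap.applyₗ (1 : Ar G)).comp (WW C u).ofConv
  have hU : ∀ f, U f = WW C u f 1 := fun _ => rfl
  have hP : ∀ f, f ∈ (Submodule.map (LinearMap.mulLeft ℚ (zdel s : Ar G))
      (Subalgebra.toSubmodule Qz)).comap U ↔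
      ∃ c ∈ (Qz : Subalgebra ℚ (Ar G)), WW C u f 1 = zdel s * c := by
    intro f
    rw [Submodule.mem_comap, Submodule.mem_map, hU]
    simp only [Subalgebra.mem_toSubmodule, LinearMap.mulLeft_apply, eq_comm]
  rw [← hP]
  refine C.hgen _ ?_ ?_ ?_ f
  · rw [hP]; exact ⟨0, zero_mem _, by rw [U_one hu, mul_zero]⟩
  · intro f g hf hg
    rw [hP] at *
    obtain ⟨c, hc, e⟩ := hf
    obtain ⟨d, hd, e'⟩ := hg
    refine ⟨counit (R := ℚ) f • d - d * zet * c + counit (R := ℚ) g • c,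
      add_mem (sub_mem (Subalgebra.smul_mem _ hd _) (mul_mem (mul_mem hd zet_mem) hc))
        (Subalgebra.smul_mem _ hc _), ?_⟩
    have h1 : WW C u g (zdel s) = WW C u g 1 * zet - counit (R := ℚ) g • zdel s
        + C.T (antipode ℚ g) (zdel s) := by
      have h2 := WW_sub_v hu g
      have h3 := WW_mul_c C u zet zet_mem g 1
      rw [one_mul] at h3
      rw [map_sub, h3] at h2
      rw [← sub_eq_zero] at h2 ⊢
      rw [← neg_eq_zero, ← h2]; abel
    rw [U_mul hu, e, WW_mul_c C u c hc, T_mul_c C c hc, h1, e']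
    simp only [mul_add, mul_sub, add_mul, sub_mul, mul_smul_comm, smul_mul_assoc, mul_assoc]
    abel
  · intro f hf
    rw [hP] at *
    obtain ⟨c, hc, e⟩ := hf
    refine ⟨counit (R := ℚ) f • 1 + c * zet,
      add_mem (Subalgebra.smul_mem _ (one_mem _) _) (mul_mem hc zet_mem), ?_⟩
    rw [U_Bp hu, e, mul_add, mul_smul_comm, mul_one, mul_assoc]

/-- the key structural fact: `t = v + t * c * (z - v)` with `c` valued in `ℚ[z]` -/
lemma exists_c (C : CKSetup G H) (s : G) : ∃ c : WithConv (H →ₗ[ℚ] Ar G),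
    (∀ f, c f ∈ (Qz : Subalgebra ℚ (Ar G))) ∧
    rho C (zdel s) = kk H (zdel s) + rho C (zdel s) * c * kk H (zet - zdel s) := by
  obtain ⟨u, hu⟩ := exists_u C s
  obtain ⟨g, hg⟩ := LinearMap.exists_leftInverse_of_injective
    (LinearMap.mulLeft ℚ (zdel s : Ar G))
    (LinearMap.ker_eq_bot.2 (mul_right_injective₀ (zdel_ne s)))
  have hg' : ∀ w, g (zdel s * w) = w := fun w => congrArg (fun L => L w) hg
  let c : WithConv (H →ₗ[ℚ] Ar G) :=
    toConv (g ∘ₗ (LinearMap.applyₗ (1 : Ar G)).comp (WW C u).ofConv)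
  have hc : ∀ f, c f ∈ (Qz : Subalgebra ℚ (Ar G)) ∧ WW C u f 1 = zdel s * c f := by
    intro f
    obtain ⟨d, hd, e⟩ := U_mem hu f
    have : c f = d := by change g (WW C u f 1) = d; rw [e, hg']
    rw [this]; exact ⟨hd, e⟩
  refine ⟨c, fun f => (hc f).1, ?_⟩
  suffices h : u = rho C (zdel s) * c by rw [← h]; exact hu
  apply conv_ext; intro f
  have h1 : lW u = Tc C * WW C u := by
    unfold WW; rw [← mul_assoc, Tc_Th, kone_mul]
  have h2 : u f = lW u f 1 := by simp
  rw [h2, h1, (ℛ ℚ f).convMul_apply, (ℛ ℚ f).convMul_apply, LinearMap.sum_apply]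
  refine Finset.sum_congr rfl fun i _ => ?_
  rw [Module.End.mul_apply, Tc_apply, (hc _).2, T_mul_c C _ (hc _).1]; rfl

lemma That_rec {C : CKSetup G H} {s : G} {c : WithConv (H →ₗ[ℚ] Ar G)}
    (hc : ∀ f, c f ∈ (Qz : Subalgebra ℚ (Ar G)))
    (ht : rho C (zdel s) = kk H (zdel s) + rho C (zdel s) * c * kk H (zet - zdel s))
    (f : H) (b : Ar G) :
    C.T (antipode ℚ f) (zdel s * b) = zdel s * C.T (antipode ℚ f) b
      - zdel s * ∑ i ∈ (ℛ ℚ f).index, c ((ℛ ℚ f).right i) *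
        C.T (antipode ℚ ((ℛ ℚ f).left i)) ((zet - zdel s) * b) := by
  have h : WW C (rho C (zdel s)) f b
      = WW C (kk H (zdel s) + rho C (zdel s) * c * kk H (zet - zdel s)) f b := by
    rw [← ht]
  rw [WW_add, WW_mul_kk, WW_rho_mul, WW_kk, WW_rho, WW_apply] at h
  rw [eq_sub_iff_add_eq, h]
  congr 2
  refine Finset.sum_congr rfl fun i _ => ?_
  rw [T_c_mul C _ (hc _)]

lemma Tp_rec {C : CKSetup G H} {s : G} {c : WithConv (H →ₗ[ℚ] Ar G)}
    (hc : ∀ f, c f ∈ (Qz : Subalgebra ℚ (Ar G)))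
    (ht : rho C (zdel s) = kk H (zdel s) + rho C (zdel s) * c * kk H (zet - zdel s))
    (f : H) (b : Ar G) :
    tauR (C.T f (tauR (zdel s * b))) = zdel s * tauR (C.T f (tauR b))
      - zdel s * ∑ i ∈ (ℛ ℚ f).index, c ((ℛ ℚ f).right i) *
        tauR (C.T ((ℛ ℚ f).left i) (tauR ((zet - zdel s) * b))) := by
  have h : rho C (tauR b * (zet - zdel s)) = rho C (tauR b) * kk H (zet - zdel s)
      - rho C (tauR b * zdel s) * c * kk H (zet - zdel s) := by
    rw [rho_mul C _ (zdel s), rho_mul, rho_sub, rho_z]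
    nth_rw 1 [ht]
    rw [← sub_sub, ← kk_sub, mul_sub]
    simp only [mul_assoc]
  have h' := congrArg (fun L => L f) h
  change C.T f _ = (rho C (tauR b) * kk H (zet - zdel s) : WithConv (H →ₗ[ℚ] Ar G)) f
    - (rho C (tauR b * zdel s) * c * kk H (zet - zdel s) : WithConv (H →ₗ[ℚ] Ar G)) f at h'
  rw [mul_kk, mul_kk, (ℛ ℚ f).convMul_apply] at h'
  rw [tau_mul, tau_zdel, h', map_sub, tau_mul, tau_mul, map_sub, tau_z, tau_zdel, sub_sub_cancel,
    map_sum]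
  congr 2
  refine Finset.sum_congr rfl fun i _ => ?_
  rw [tau_mul, (tau_c _ (hc _)).1, tau_mul, map_sub, tau_z, tau_zdel, sub_sub_cancel]; rfl

lemma main (C : CKSetup G H) (a : Ar G) :
    ∀ f : H, C.T (antipode ℚ f) a = tauR (C.T f (tauR a)) := by
  refine gen_induction (fun a => ∀ f : H, C.T (antipode ℚ f) a = tauR (C.T f (tauR a)))
    ?_ ?_ ?_ ?_ ?_ a
  · intro f
    rw [That_one, tau_one, T_one_eq, map_smul, tau_one]
  · intro a b ha hb f
    simp only [map_add, ha, hb]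
  · intro r a ha f
    simp only [map_smul, ha]
  · intro b hb f
    rw [T_z_mul, hb, tau_mul, tau_z, T_mul_z, tau_mul, tau_z]
  · intro s b hb
    obtain ⟨c, hc, ht⟩ := exists_c C s
    have key := deg_zero (H := H) s (fun f => c f)
      (fun f => C.T (antipode ℚ f) (zdel s * b) - tauR (C.T f (tauR (zdel s * b)))) (by
        intro f
        nth_rw 1 [That_rec hc ht, Tp_rec hc ht]
        rw [hb, sub_sub_sub_cancel_left, ← mul_sub, ← Finset.sum_sub_distrib]
        congr 1
        refine Finset.sum_congr rfl fun i _ => ?_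
        rw [← mul_sub]
        congr 1
        have h1 : C.T (antipode ℚ ((ℛ ℚ f).left i)) (zet * b)
            = tauR (C.T ((ℛ ℚ f).left i) (tauR (zet * b))) := by
          rw [T_z_mul, hb, tau_mul, tau_z, T_mul_z, tau_mul, tau_z]
        rw [sub_mul]
        simp only [map_sub]
        rw [h1]
        abel)
    intro f
    exact sub_eq_zero.1 (key f)

end RTM

/-- For every `f ∈ H`, the rooted tree map of `S(f)` is the `τ`-conjugate of the rooted
tree map of `f`: `(S(f))~ = τ ∘ f̃ ∘ τ` on `A_r`. -/
theorem statement18 {G : Type} [CommGroup G] {H : Type} [CommRing H] [HopfAlgebra ℚ H]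
    (C : CKSetup G H) (f : H) (a : Ar G) :
    C.T (HopfAlgebra.antipode (R := ℚ) f) a = tauR (C.T f (tauR a)) := by
  exact RTM.main C a f
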